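/- (Theorem 2: exponential stability.) Suppose additionally that μ(x) = γ m(x) for a constant γ > 0. Let β₀ = (ℓ²/2)√(m₁/r₀), β₁ = β₀ · (1 + (1/√(m₁ r₀)) · (ℓ² μ₁ + (2/ℓ)(k_a⁻ + k_a⁺))), and let λ be any real number with 0 < λ < min(1/β₀, γ m₀/(2 m₁)). Set M = (1 + β₁ λ)/(1 − β₀ λ) and σ = 2λ/(1 + β₁ λ). Then for every t ∈ [0,T], E(t) ≤ M e^{−σ t} E(0). -/

import Mathlib

open Set intervalIntegral

noncomputable def pdx (u : ℝ → ℝ → ℝ) (x t : ℝ) : ℝ := deriv (fun y => u y t) x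
noncomputable def pdt (u : ℝ → ℝ → ℝ) (x t : ℝ) : ℝ := deriv (fun s => u x s) t

noncomputable def beamEnergy (m r : ℝ → ℝ) (krm krp ℓ : ℝ) (u : ℝ → ℝ → ℝ) (t : ℝ) : ℝ :=
  (1/2) * (∫ x in (0:ℝ)..ℓ, (m x * (pdt u x t)^2 + r x * (pdx (pdx u) x t)^2))
    + (1/2) * krm * (pdx u 0 t)^2 + (1/2) * krp * (pdx u ℓ t)^2

open MeasureTheory

section Smooth

variable {u : ℝ → ℝ → ℝ}

theorem hasDerivAt_fst_of_contDiff (hu : ContDiff ℝ (⊤ : ℕ∞) (Function.uncurry u)) (x t : ℝ) :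
    HasDerivAt (fun y => u y t) (fderiv ℝ (Function.uncurry u) (x, t) (1, 0)) x :=
  HasFDerivAt.comp_hasDerivAt (f := fun y : ℝ => (y, t)) x
    ((hu.differentiable (by simp)) (x, t)).hasFDerivAt
    ((hasDerivAt_id x).prodMk (hasDerivAt_const x t))

theorem hasDerivAt_snd_of_contDiff (hu : ContDiff ℝ (⊤ : ℕ∞) (Function.uncurry u)) (x t : ℝ) :
    HasDerivAt (fun s => u x s) (fderiv ℝ (Function.uncurry u) (x, t) (0, 1)) t :=
  HasFDerivAt.comp_hasDerivAt (f := fun s : ℝ => (x, s)) t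
    ((hu.differentiable (by simp)) (x, t)).hasFDerivAt
    ((hasDerivAt_const t x).prodMk (hasDerivAt_id t))

theorem uncurry_pdx_eq (hu : ContDiff ℝ (⊤ : ℕ∞) (Function.uncurry u)) :
    Function.uncurry (pdx u) = fun p => fderiv ℝ (Function.uncurry u) p (1, 0) :=
  funext fun p => (hasDerivAt_fst_of_contDiff hu p.1 p.2).deriv

theorem uncurry_pdt_eq (hu : ContDiff ℝ (⊤ : ℕ∞) (Function.uncurry u)) :
    Function.uncurry (pdt u) = fun p => fderiv ℝ (Function.uncurry u) p (0, 1) :=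
  funext fun p => (hasDerivAt_snd_of_contDiff hu p.1 p.2).deriv

theorem contDiff_pdx (hu : ContDiff ℝ (⊤ : ℕ∞) (Function.uncurry u)) :
    ContDiff ℝ (⊤ : ℕ∞) (Function.uncurry (pdx u)) := by
  rw [uncurry_pdx_eq hu]
  exact (hu.fderiv_right (m := ((⊤ : ℕ∞) : WithTop ℕ∞)) (by simp)).clm_apply contDiff_const

theorem contDiff_pdt (hu : ContDiff ℝ (⊤ : ℕ∞) (Function.uncurry u)) :
    ContDiff ℝ (⊤ : ℕ∞) (Function.uncurry (pdt u)) := by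
  rw [uncurry_pdt_eq hu]
  exact (hu.fderiv_right (m := ((⊤ : ℕ∞) : WithTop ℕ∞)) (by simp)).clm_apply contDiff_const

theorem hasDerivAt_pdx (hu : ContDiff ℝ (⊤ : ℕ∞) (Function.uncurry u)) (x t : ℝ) :
    HasDerivAt (fun y => u y t) (pdx u x t) x :=
  (hasDerivAt_fst_of_contDiff hu x t).differentiableAt.hasDerivAt

theorem hasDerivAt_pdt (hu : ContDiff ℝ (⊤ : ℕ∞) (Function.uncurry u)) (x t : ℝ) :
    HasDerivAt (fun s => u x s) (pdt u x t) t :=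
  (hasDerivAt_snd_of_contDiff hu x t).differentiableAt.hasDerivAt

theorem continuous_slice (hu : ContDiff ℝ (⊤ : ℕ∞) (Function.uncurry u)) (t : ℝ) :
    Continuous fun x => u x t :=
  hu.continuous.comp (by fun_prop : Continuous fun x : ℝ => (x, t))

theorem pdt_pdx_comm (hu : ContDiff ℝ (⊤ : ℕ∞) (Function.uncurry u)) :
    pdt (pdx u) = pdx (pdt u) := by
  funext x t
  have hd : DifferentiableAt ℝ (fderiv ℝ (Function.uncurry u)) (x, t) :=
    ((hu.fderiv_right (m := ((⊤ : ℕ∞) : WithTop ℕ∞)) (by simp)).differentiable (by simp)) _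
  have h1 := (hasDerivAt_snd_of_contDiff (contDiff_pdx hu) x t).deriv
  have h2 := (hasDerivAt_fst_of_contDiff (contDiff_pdt hu) x t).deriv
  rw [uncurry_pdx_eq hu, fderiv_clm_apply hd (differentiableAt_const _)] at h1
  rw [uncurry_pdt_eq hu, fderiv_clm_apply hd (differentiableAt_const _)] at h2
  have hs : IsSymmSndFDerivAt ℝ (Function.uncurry u) (x, t) :=
    hu.contDiffAt.isSymmSndFDerivAt <| by
      rw [minSmoothness_of_isRCLikeNormedField]
      exact WithTop.coe_le_coe.2 (le_top (a := ((2 : ℕ) : ℕ∞)))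
  have := hs.eq (0, 1) (1, 0)
  simp at h1 h2
  change deriv _ _ = deriv _ _
  rw [h1, h2, this]

end Smooth

section Integrals

variable {a b : ℝ}

theorem hasDerivAt_integral_weight_mul {w : ℝ → ℝ} {g g' : ℝ → ℝ → ℝ} (hab : a ≤ b)
    (hw : ContinuousOn w (Icc a b)) (hg : Continuous (Function.uncurry g))
    (hg' : Continuous (Function.uncurry g')) (hd : ∀ x t, HasDerivAt (fun s => g x s) (g' x t) t)
    (t : ℝ) :
    HasDerivAt (fun s => ∫ x in a..b, w x * g x s) (∫ x in a..b, w x * g' x t) t := by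
  have slice : ∀ {f : ℝ → ℝ → ℝ}, Continuous (Function.uncurry f) → ∀ s,
      IntervalIntegrable (fun x => w x * f x s) volume a b := fun hf s =>
    ContinuousOn.intervalIntegrable_of_Icc hab
      (hw.mul (hf.comp (by fun_prop : Continuous fun x : ℝ => (x, s))).continuousOn)
  obtain ⟨C, hC⟩ := (isCompact_Icc.prod (isCompact_closedBall t 1)).exists_bound_of_continuousOn
    (f := fun p : ℝ × ℝ => w p.1 * g' p.1 p.2)
    ((hw.comp continuousOn_fst fun p hp => hp.1).mul hg'.continuousOn)
  refine (hasDerivAt_integral_of_dominated_loc_of_deriv_le (bound := fun _ => C)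
    (F := fun s x => w x * g x s) (F' := fun s x => w x * g' x s)
    (Metric.closedBall_mem_nhds t one_pos) (Filter.Eventually.of_forall fun s => ?_)
    (slice hg t) ?_ (Filter.Eventually.of_forall fun x hx s hs => ?_)
    intervalIntegrable_const
    (Filter.Eventually.of_forall fun x _ s _ => (hd x s).const_mul (w x))).2
  · exact (intervalIntegrable_iff.1 (slice hg s)).aestronglyMeasurable
  · exact (intervalIntegrable_iff.1 (slice hg' t)).aestronglyMeasurable
  · rw [uIoc_of_le hab] at hx
    exact hC (x, s) ⟨Ioc_subset_Icc_self hx, hs⟩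

theorem integral_deriv_deriv_mul {q q' q'' v v' v'' : ℝ → ℝ}
    (hq : ∀ x, HasDerivAt q (q' x) x) (hq' : ∀ x, HasDerivAt q' (q'' x) x) (cq : Continuous q'')
    (hv : ∀ x, HasDerivAt v (v' x) x) (hv' : ∀ x, HasDerivAt v' (v'' x) x) (cv : Continuous v'')
    (ha : v a = 0) (hb : v b = 0) :
    ∫ x in a..b, q'' x * v x = q a * v' a - q b * v' b + ∫ x in a..b, q x * v'' x := by
  have cq' : Continuous q' := continuous_iff_continuousAt.2 fun x => (hq' x).continuousAt
  have cv' : Continuous v' := continuous_iff_continuousAt.2 fun x => (hv' x).continuousAt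
  have h1 := integral_mul_deriv_eq_deriv_mul (a := a) (b := b) (fun x _ => hv x) (fun x _ => hq' x)
    (cv'.intervalIntegrable _ _) (cq.intervalIntegrable _ _)
  have h2 := integral_mul_deriv_eq_deriv_mul (a := a) (b := b) (fun x _ => hv' x) (fun x _ => hq x)
    (cv.intervalIntegrable _ _) (cq'.intervalIntegrable _ _)
  simp only [mul_comm (q'' _), mul_comm (q _)]
  rw [h1, h2, ha, hb]
  ring

theorem sq_integral_abs_le {f : ℝ → ℝ} (hab : a < b) (hf : Continuous f) :
    (∫ x in a..b, |f x|) ^ 2 ≤ (b - a) * ∫ x in a..b, f x ^ 2 := by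
  set S := ∫ x in a..b, |f x| with hS
  have h0 : 0 ≤ ∫ x in a..b, ((b - a) * |f x| - S) ^ 2 :=
    integral_nonneg hab.le fun x _ => sq_nonneg _
  have hexp : ∫ x in a..b, ((b - a) * |f x| - S) ^ 2
      = (b - a) ^ 2 * (∫ x in a..b, f x ^ 2) - 2 * (b - a) * S * S + (b - a) * S ^ 2 := by
    have : ∀ x, ((b - a) * |f x| - S) ^ 2
        = (b - a) ^ 2 * f x ^ 2 - 2 * (b - a) * S * |f x| + S ^ 2 := fun x => by
      rw [← sq_abs (f x)]; ring
    simp only [this]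
    rw [intervalIntegral.integral_add, intervalIntegral.integral_sub,
      intervalIntegral.integral_const_mul, intervalIntegral.integral_const_mul,
      intervalIntegral.integral_const, ← hS, smul_eq_mul]
    all_goals exact Continuous.intervalIntegrable (by fun_prop) _ _
  rw [hexp] at h0
  have hpos : 0 < b - a := sub_pos.2 hab
  have : 0 ≤ (b - a) * ((b - a) * (∫ x in a..b, f x ^ 2) - S ^ 2) := by linarith
  linarith [nonneg_of_mul_nonneg_right this hpos]

variable {f f' f'' : ℝ → ℝ}

theorem sq_deriv_le_of_eq_zero_endpoints (hab : a < b) (hf : ∀ x, HasDerivAt f (f' x) x)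
    (hf' : ∀ x, HasDerivAt f' (f'' x) x) (cf : Continuous f'') (ha : f a = 0) (hb : f b = 0)
    {x : ℝ} (hx : x ∈ Icc a b) :
    f' x ^ 2 ≤ (b - a) * ∫ y in a..b, f'' y ^ 2 := by
  obtain ⟨c, hc, hc0⟩ := exists_hasDerivAt_eq_zero hab
    (fun y _ => (hf y).continuousAt.continuousWithinAt) (ha.trans hb.symm) (fun y _ => hf y)
  have hint := integral_eq_sub_of_hasDerivAt (a := c) (b := x) (fun y _ => hf' y)
    (cf.intervalIntegrable _ _)
  rw [hc0, sub_zero] at hint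
  refine le_trans ?_ (sq_integral_abs_le hab cf)
  rw [← sq_abs (f' x), ← hint]
  refine pow_le_pow_left₀ (abs_nonneg _) ?_ 2
  refine (norm_integral_le_abs_integral_norm (f := f'')).trans ?_
  refine (abs_integral_mono_interval (c := a) (d := b) ?_
    (Filter.Eventually.of_forall fun y => abs_nonneg _) (cf.abs.intervalIntegrable _ _)).trans_eq (abs_of_nonneg ?_)
  · rw [uIoc_of_le hab.le]
    exact Ioc_subset_Ioc (le_min hc.1.le hx.1) (max_le hc.2.le hx.2)
  · exact integral_nonneg hab.le fun y _ => abs_nonneg _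

theorem sq_le_of_eq_zero_endpoints (hab : a < b) (hf : ∀ x, HasDerivAt f (f' x) x)
    (hf' : ∀ x, HasDerivAt f' (f'' x) x) (cf : Continuous f'') (ha : f a = 0) (hb : f b = 0)
    {x : ℝ} (hx : x ∈ Icc a b) :
    f x ^ 2 ≤ (b - a) ^ 3 / 4 * ∫ y in a..b, f'' y ^ 2 := by
  set A := ∫ y in a..b, f'' y ^ 2
  have hA : 0 ≤ (b - a) * A :=
    (sq_nonneg _).trans (sq_deriv_le_of_eq_zero_endpoints hab hf hf' cf ha hb hx)
  have hB : ∀ y ∈ Icc a b, ‖f' y‖ ≤ √((b - a) * A) := fun y hy =>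
    Real.abs_le_sqrt (sq_deriv_le_of_eq_zero_endpoints hab hf hf' cf ha hb hy)
  have lip : ∀ y ∈ Icc a b, ‖f x - f y‖ ≤ √((b - a) * A) * ‖x - y‖ := fun y hy =>
    (convex_Icc a b).norm_image_sub_le_of_norm_hasDerivWithin_le
      (fun z _ => (hf z).hasDerivWithinAt) hB hy hx
  have key : |f x| ≤ √((b - a) * A) * ((b - a) / 2) := by
    rcases le_total x ((a + b) / 2) with h | h
    · have := lip a ⟨le_rfl, hab.le⟩
      rw [ha, sub_zero, Real.norm_eq_abs, Real.norm_eq_abs,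
        abs_of_nonneg (a := x - a) (by linarith [hx.1])] at this
      exact this.trans (mul_le_mul_of_nonneg_left (by linarith) (Real.sqrt_nonneg _))
    · have := lip b ⟨hab.le, le_rfl⟩
      rw [hb, sub_zero, Real.norm_eq_abs, Real.norm_eq_abs,
        abs_of_nonpos (a := x - b) (by linarith [hx.2])] at this
      exact this.trans (mul_le_mul_of_nonneg_left (by linarith) (Real.sqrt_nonneg _))
  have := pow_le_pow_left₀ (abs_nonneg _) key 2
  rw [sq_abs, mul_pow, Real.sq_sqrt hA] at this
  linarith

end Integrals

theorem le_exp_mul_of_deriv_le {V V' : ℝ → ℝ} {T σ : ℝ} (hV : ∀ t, HasDerivAt V (V' t) t)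
    (hle : ∀ t ∈ Ioo 0 T, V' t ≤ -σ * V t) {t : ℝ} (ht : t ∈ Icc 0 T) :
    V t ≤ Real.exp (-σ * t) * V 0 := by
  have hd : ∀ s, HasDerivAt (fun s => Real.exp (σ * s) * V s)
      (Real.exp (σ * s) * σ * V s + Real.exp (σ * s) * V' s) s := fun s => by
    have he : HasDerivAt (fun s => Real.exp (σ * s)) (Real.exp (σ * s) * σ) s := by
      simpa using ((hasDerivAt_id s).const_mul σ).exp
    exact he.mul (hV s)
  have hanti := antitoneOn_of_deriv_nonpos (convex_Icc 0 T)
    (fun s _ => (hd s).continuousAt.continuousWithinAt)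
    (fun s _ => (hd s).differentiableAt.differentiableWithinAt) (fun s hs => by
      rw [interior_Icc] at hs
      rw [(hd s).deriv]
      nlinarith [hle s hs, Real.exp_pos (σ * s)])
  have h := hanti ⟨le_rfl, ht.1.trans ht.2⟩ ht ht.1
  simp only [mul_zero, Real.exp_zero, one_mul] at h
  rw [neg_mul, Real.exp_neg, ← div_eq_inv_mul, le_div_iff₀' (Real.exp_pos _)]
  exact h

theorem exponential_stability
    (ℓ T m₀ m₁ μ₀ μ₁ r₀ r₁ krm kam krp kap : ℝ)
    (m μ r : ℝ → ℝ) (u : ℝ → ℝ → ℝ)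
    (hℓ : 0 < ℓ) (hT : 0 < T)
    (hm₀ : 0 < m₀) (hμ₀ : 0 ≤ μ₀) (hr₀ : 0 < r₀)
    (hmc : ContinuousOn m (Icc 0 ℓ)) (hμc : ContinuousOn μ (Icc 0 ℓ))
    (hrc : ContinuousOn r (Icc 0 ℓ))
    (hmb : ∀ x ∈ Icc 0 ℓ, m₀ ≤ m x ∧ m x ≤ m₁)
    (hμb : ∀ x ∈ Icc 0 ℓ, μ₀ ≤ μ x ∧ μ x ≤ μ₁)
    (hrb : ∀ x ∈ Icc 0 ℓ, r₀ ≤ r x ∧ r x ≤ r₁)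
    (hkrm : 0 ≤ krm) (hkam : 0 ≤ kam) (hkrp : 0 ≤ krp) (hkap : 0 ≤ kap)
    (hu : ContDiff ℝ (⊤ : ℕ∞) (Function.uncurry u))
    (hq : ContDiff ℝ (⊤ : ℕ∞) (Function.uncurry (fun x t => r x * pdx (pdx u) x t)))
    (hpde : ∀ x ∈ Ioo 0 ℓ, ∀ t ∈ Ioo 0 T,
      m x * pdt (pdt u) x t + μ x * pdt u x t
        + pdx (pdx (fun y s => r y * pdx (pdx u) y s)) x t = 0)
    (hbu0 : ∀ t ∈ Icc 0 T, u 0 t = 0)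
    (hbuℓ : ∀ t ∈ Icc 0 T, u ℓ t = 0)
    (hbm0 : ∀ t ∈ Icc 0 T,
      -(r 0 * pdx (pdx u) 0 t) = -(krm * pdx u 0 t) - kam * pdt (pdx u) 0 t)
    (hbmℓ : ∀ t ∈ Icc 0 T,
      -(r ℓ * pdx (pdx u) ℓ t) = krp * pdx u ℓ t + kap * pdt (pdx u) ℓ t)
    (γ : ℝ) (hγ : 0 < γ) (hμm : ∀ x ∈ Icc 0 ℓ, μ x = γ * m x)
    (β₀ β₁ : ℝ)
    (hβ₀ : β₀ = ℓ^2/2 * Real.sqrt (m₁/r₀))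
    (hβ₁ : β₁ = β₀ * (1 + 1/Real.sqrt (m₁*r₀) * (ℓ^2*μ₁ + 2/ℓ * (kam + kap))))
    (lam M σ : ℝ)
    (hlam₁ : 0 < lam) (hlam₂ : lam < min (1/β₀) (γ * m₀ / (2 * m₁)))
    (hM : M = (1 + β₁ * lam) / (1 - β₀ * lam))
    (hσ : σ = 2 * lam / (1 + β₁ * lam)) :
    ∀ t ∈ Icc 0 T, beamEnergy m r krm krp ℓ u t ≤ M * Real.exp (-σ * t) * beamEnergy m r krm krp ℓ u 0 := by
  have hux := contDiff_pdx hu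
  have huxx := contDiff_pdx hux
  have hut := contDiff_pdt hu
  have hutt := contDiff_pdt hut
  have hutx := contDiff_pdx hut
  have int : ∀ {w g : ℝ → ℝ}, ContinuousOn w (Icc 0 ℓ) → Continuous g →
      IntervalIntegrable (fun x => w x * g x) volume 0 ℓ := fun hw hg =>
    (hw.mul hg.continuousOn).intervalIntegrable_of_Icc hℓ.le
  have hm₁ : 0 < m₁ :=
    hm₀.trans_le ((hmb 0 ⟨le_rfl, hℓ.le⟩).1.trans (hmb 0 ⟨le_rfl, hℓ.le⟩).2)
  have hμ₁ : 0 ≤ μ₁ :=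
    hμ₀.trans ((hμb 0 ⟨le_rfl, hℓ.le⟩).1.trans (hμb 0 ⟨le_rfl, hℓ.le⟩).2)
  set K : ℝ → ℝ := fun t => ∫ x in (0:ℝ)..ℓ, m x * (pdt u x t) ^ 2 with hK
  set P : ℝ → ℝ := fun t => ∫ x in (0:ℝ)..ℓ, r x * (pdx (pdx u) x t) ^ 2 with hP
  set L : ℝ → ℝ := fun t => ∫ x in (0:ℝ)..ℓ, m x * (u x t * pdt u x t) with hL
  set N : ℝ → ℝ := fun t => ∫ x in (0:ℝ)..ℓ, μ x * (u x t) ^ 2 with hN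
  set E : ℝ → ℝ := beamEnergy m r krm krp ℓ u with hEdef
  have hE : ∀ t, E t = 1 / 2 * (K t + P t) + 1 / 2 * krm * (pdx u 0 t) ^ 2
      + 1 / 2 * krp * (pdx u ℓ t) ^ 2 := fun t => by
    rw [hEdef, hK, hP, beamEnergy,
      intervalIntegral.integral_add (int hmc ((continuous_slice hut t).fun_pow 2))
        (int hrc ((continuous_slice huxx t).fun_pow 2))]
  have hK0 : ∀ t, 0 ≤ K t := fun t => integral_nonneg hℓ.le fun x hx =>
    mul_nonneg (hm₀.le.trans (hmb x hx).1) (sq_nonneg _)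
  have hP0 : ∀ t, 0 ≤ P t := fun t => integral_nonneg hℓ.le fun x hx =>
    mul_nonneg (hr₀.le.trans (hrb x hx).1) (sq_nonneg _)
  have hN0 : ∀ t, 0 ≤ N t := fun t => integral_nonneg hℓ.le fun x hx =>
    mul_nonneg (hμ₀.trans (hμb x hx).1) (sq_nonneg _)
  set J : ℝ → ℝ := fun t =>
    1 / 2 * N t + 1 / 2 * kam * (pdx u 0 t) ^ 2 + 1 / 2 * kap * (pdx u ℓ t) ^ 2 with hJ
  have hJ0 : ∀ t, 0 ≤ J t := fun t => by
    have := hN0 t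
    simp only [hJ]
    positivity
  have hβ₀pos : 0 < β₀ := by
    rw [hβ₀]
    positivity
  have hβ₀sq : β₀ ^ 2 * r₀ = ℓ ^ 4 / 4 * m₁ := by
    rw [hβ₀, mul_pow, Real.sq_sqrt (by positivity)]
    field_simp
    ring
  have hβ₁' : β₁ - β₀ = ℓ ^ 2 / (2 * r₀) * (ℓ ^ 2 * μ₁ + 2 / ℓ * (kam + kap)) := by
    have hs : √(m₁ / r₀) * (1 / √(m₁ * r₀)) = 1 / r₀ := by
      rw [Real.sqrt_div hm₁.le, Real.sqrt_mul hm₁.le]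
      have h1 : √m₁ ≠ 0 := (Real.sqrt_pos.2 hm₁).ne'
      have h2 : √r₀ ≠ 0 := (Real.sqrt_pos.2 hr₀).ne'
      have h3 : √r₀ ^ 2 = r₀ := Real.sq_sqrt hr₀.le
      field_simp
      rw [h3]
    calc β₁ - β₀ = ℓ ^ 2 / 2 * (√(m₁ / r₀) * (1 / √(m₁ * r₀)))
          * (ℓ ^ 2 * μ₁ + 2 / ℓ * (kam + kap)) := by rw [hβ₁, hβ₀]; ring
      _ = _ := by rw [hs]; field_simp
  have hPA : ∀ t, r₀ * (∫ x in (0:ℝ)..ℓ, (pdx (pdx u) x t) ^ 2) ≤ P t := fun t => by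
    rw [← intervalIntegral.integral_const_mul]
    exact integral_mono_on hℓ.le
      (int continuousOn_const ((continuous_slice huxx t).fun_pow 2))
      (int hrc ((continuous_slice huxx t).fun_pow 2))
      fun x hx => mul_le_mul_of_nonneg_right (hrb x hx).1 (sq_nonneg _)
  have hux_le : ∀ t ∈ Icc 0 T, ∀ x ∈ Icc 0 ℓ, (pdx u x t) ^ 2 ≤ ℓ / r₀ * P t := by
    intro t ht x hx
    have h := sq_deriv_le_of_eq_zero_endpoints hℓ (fun x => hasDerivAt_pdx hu x t)
      (fun x => hasDerivAt_pdx hux x t) (continuous_slice huxx t) (hbu0 t ht) (hbuℓ t ht) hx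
    rw [sub_zero] at h
    rw [div_mul_eq_mul_div, le_div_iff₀ hr₀]
    nlinarith [mul_le_mul_of_nonneg_left (hPA t) hℓ.le, mul_le_mul_of_nonneg_right h hr₀.le]
  have hu_le : ∀ t ∈ Icc 0 T, ∀ x ∈ Icc 0 ℓ, (u x t) ^ 2 ≤ ℓ ^ 3 / (4 * r₀) * P t := by
    intro t ht x hx
    have h := sq_le_of_eq_zero_endpoints hℓ (fun x => hasDerivAt_pdx hu x t)
      (fun x => hasDerivAt_pdx hux x t) (continuous_slice huxx t) (hbu0 t ht) (hbuℓ t ht) hx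
    rw [sub_zero] at h
    rw [div_mul_eq_mul_div, le_div_iff₀ (by positivity)]
    have h3 : 0 < ℓ ^ 3 := by positivity
    nlinarith [mul_le_mul_of_nonneg_left (hPA t) h3.le, mul_le_mul_of_nonneg_right h hr₀.le]
  have hL_le : ∀ t ∈ Icc 0 T, |L t| ≤ β₀ / 2 * (K t + P t) := by
    intro t ht
    have hpt : ∀ x ∈ Icc 0 ℓ, |m x * (u x t * pdt u x t)|
        ≤ m x * (β₀ / 2 * (pdt u x t) ^ 2) + β₀ / (2 * ℓ) * P t := by
      intro x hx
      have hmx : 0 < m x := hm₀.trans_le (hmb x hx).1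
      have h1 : m x * (u x t) ^ 2 ≤ m₁ * (ℓ ^ 3 / (4 * r₀) * P t) :=
        mul_le_mul (hmb x hx).2 (hu_le t ht x hx) (sq_nonneg _) hm₁.le
      have h2 : m₁ * (ℓ ^ 3 / (4 * r₀) * P t) = β₀ ^ 2 / ℓ * P t := by
        have : m₁ * ℓ ^ 4 = 4 * (β₀ ^ 2 * r₀) := by rw [hβ₀sq]; ring
        field_simp
        linear_combination P t * this
      have h3 : 2 * β₀ * |u x t * pdt u x t| ≤ (u x t) ^ 2 + β₀ ^ 2 * (pdt u x t) ^ 2 := by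
        rw [abs_mul, ← sq_abs (u x t), ← sq_abs (pdt u x t)]
        nlinarith [sq_nonneg (|u x t| - β₀ * |pdt u x t|)]
      rw [abs_mul, abs_of_pos hmx]
      have h4 := mul_le_mul_of_nonneg_left h3 hmx.le
      refine le_of_mul_le_mul_left ?_ (by positivity : 0 < 2 * β₀)
      have h5 : 2 * β₀ * (β₀ / (2 * ℓ) * P t) = β₀ ^ 2 / ℓ * P t := by field_simp
      rw [mul_add, h5]
      linarith
    have hi1 := int hmc (g := fun x => β₀ / 2 * (pdt u x t) ^ 2)
      (continuous_const.mul ((continuous_slice hut t).fun_pow 2))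
    have hi2 := int hmc (g := fun x => u x t * pdt u x t)
      ((continuous_slice hu t).fun_mul (continuous_slice hut t))
    calc |L t| ≤ ∫ x in (0:ℝ)..ℓ, |m x * (u x t * pdt u x t)| :=
          abs_integral_le_integral_abs hℓ.le
      _ ≤ ∫ x in (0:ℝ)..ℓ, (m x * (β₀ / 2 * (pdt u x t) ^ 2) + β₀ / (2 * ℓ) * P t) :=
          integral_mono_on hℓ.le hi2.abs (hi1.add intervalIntegrable_const) hpt
      _ = β₀ / 2 * (K t + P t) := by
          rw [intervalIntegral.integral_add hi1 intervalIntegrable_const, intervalIntegral.integral_const, smul_eq_mul]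
          simp only [mul_left_comm (m _), intervalIntegral.integral_const_mul, hK]
          field_simp
          ring
  have hJ_le : ∀ t ∈ Icc 0 T, J t ≤ (β₁ - β₀) * E t := by
    intro t ht
    have hN_le : N t ≤ ℓ * (μ₁ * (ℓ ^ 3 / (4 * r₀) * P t)) := by
      have h := integral_mono_on hℓ.le (int hμc ((continuous_slice hu t).fun_pow 2))
        (intervalIntegrable_const (c := μ₁ * (ℓ ^ 3 / (4 * r₀) * P t)))
        fun x hx => mul_le_mul (hμb x hx).2 (hu_le t ht x hx) (sq_nonneg _) hμ₁
      rwa [intervalIntegral.integral_const, smul_eq_mul, sub_zero] at h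
    have hPE : P t ≤ 2 * E t := by
      have h1 := hK0 t
      have h2 : 0 ≤ krm * (pdx u 0 t) ^ 2 := by positivity
      have h3 : 0 ≤ krp * (pdx u ℓ t) ^ 2 := by positivity
      rw [hE t]
      linarith
    have hm0 := mul_le_mul_of_nonneg_left (hux_le t ht 0 ⟨le_rfl, hℓ.le⟩) hkam
    have hmℓ := mul_le_mul_of_nonneg_left (hux_le t ht ℓ ⟨hℓ.le, le_rfl⟩) hkap
    have hP := hP0 t
    have hid : (β₁ - β₀) * (P t / 2) = ℓ * (μ₁ * (ℓ ^ 3 / (4 * r₀) * P t))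
        + 1 / 2 * (kam * (ℓ / r₀ * P t)) + 1 / 2 * (kap * (ℓ / r₀ * P t)) := by
      rw [hβ₁']
      field_simp
      ring
    have hnn : 0 ≤ ℓ * (μ₁ * (ℓ ^ 3 / (4 * r₀) * P t)) := by positivity
    have hβ : 0 ≤ β₁ - β₀ := by rw [hβ₁']; positivity
    have hfin := mul_le_mul_of_nonneg_left hPE hβ
    simp only [hJ]
    linarith
  have hKPE : ∀ t, 1 / 2 * (K t + P t) ≤ E t := fun t => by
    have h2 : 0 ≤ krm * (pdx u 0 t) ^ 2 := by positivity
    have h3 : 0 ≤ krp * (pdx u ℓ t) ^ 2 := by positivity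
    rw [hE t]
    linarith
  have hLE : ∀ t ∈ Icc 0 T, |L t| ≤ β₀ * E t := fun t ht => by
    have := mul_le_mul_of_nonneg_left (hKPE t) hβ₀pos.le
    linarith [hL_le t ht]
  set V : ℝ → ℝ := fun t => E t + lam * (L t + J t) with hV
  have hV_upper : ∀ t ∈ Icc 0 T, V t ≤ (1 + β₁ * lam) * E t := fun t ht => by
    have h : L t + J t ≤ β₁ * E t := by
      linarith [hJ_le t ht, hLE t ht, le_abs_self (L t)]
    have := mul_le_mul_of_nonneg_left h hlam₁.le
    simp only [hV]
    linarith
  have hV_lower : ∀ t ∈ Icc 0 T, (1 - β₀ * lam) * E t ≤ V t := fun t ht => by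
    have h : -(β₀ * E t) ≤ L t + J t := by
      linarith [hJ0 t, hLE t ht, neg_abs_le (L t)]
    have := mul_le_mul_of_nonneg_left h hlam₁.le
    simp only [hV]
    linarith
  have hdK : ∀ t, HasDerivAt K (∫ x in (0:ℝ)..ℓ, m x * (2 * (pdt u x t * pdt (pdt u) x t))) t :=
    hasDerivAt_integral_weight_mul hℓ.le hmc (g := fun x t => (pdt u x t) ^ 2)
      (g' := fun x t => 2 * (pdt u x t * pdt (pdt u) x t)) (hut.continuous.fun_pow 2)
      (continuous_const.mul (hut.continuous.mul hutt.continuous))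
      fun x t => by
        refine HasDerivAt.congr_deriv ((hasDerivAt_pdt hut x t).fun_pow 2) ?_
        norm_num
        ring
  have hdP : ∀ t, HasDerivAt P
      (∫ x in (0:ℝ)..ℓ, r x * (2 * (pdx (pdx u) x t * pdt (pdx (pdx u)) x t))) t :=
    hasDerivAt_integral_weight_mul hℓ.le hrc (g := fun x t => (pdx (pdx u) x t) ^ 2)
      (g' := fun x t => 2 * (pdx (pdx u) x t * pdt (pdx (pdx u)) x t)) (huxx.continuous.fun_pow 2)
      (continuous_const.mul (huxx.continuous.mul (contDiff_pdt huxx).continuous))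
      fun x t => by
        refine HasDerivAt.congr_deriv ((hasDerivAt_pdt huxx x t).fun_pow 2) ?_
        norm_num
        ring
  have hdL : ∀ t, HasDerivAt L
      (∫ x in (0:ℝ)..ℓ, m x * (pdt u x t * pdt u x t + u x t * pdt (pdt u) x t)) t :=
    hasDerivAt_integral_weight_mul hℓ.le hmc (g := fun x t => u x t * pdt u x t)
      (g' := fun x t => pdt u x t * pdt u x t + u x t * pdt (pdt u) x t)
      (hu.continuous.mul hut.continuous)
      ((hut.continuous.mul hut.continuous).add (hu.continuous.mul hutt.continuous))
      fun x t => (hasDerivAt_pdt hu x t).mul (hasDerivAt_pdt hut x t)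
  have hdN : ∀ t, HasDerivAt N (∫ x in (0:ℝ)..ℓ, μ x * (2 * (u x t * pdt u x t))) t :=
    hasDerivAt_integral_weight_mul hℓ.le hμc (g := fun x t => (u x t) ^ 2)
      (g' := fun x t => 2 * (u x t * pdt u x t)) (hu.continuous.fun_pow 2)
      (continuous_const.mul (hu.continuous.mul hut.continuous))
      fun x t => by
        refine HasDerivAt.congr_deriv ((hasDerivAt_pdt hu x t).fun_pow 2) ?_
        norm_num
        ring
  have hdsq : ∀ c x t, HasDerivAt (fun s => 1 / 2 * c * (pdx u x s) ^ 2)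
      (c * (pdx u x t * pdt (pdx u) x t)) t := fun c x t => by
    refine HasDerivAt.congr_deriv (((hasDerivAt_pdt hux x t).fun_pow 2).const_mul (1 / 2 * c)) ?_
    norm_num
    ring
  have hdV := fun t => (((((hdK t).add (hdP t)).const_mul (1 / 2)).add (hdsq krm 0 t)).add
    (hdsq krp ℓ t)).add (((hdL t).add ((((hdN t).const_mul (1 / 2)).add (hdsq kam 0 t)).add
    (hdsq kap ℓ t))).const_mul lam)
  have hVeq : V = fun t => 1 / 2 * (K t + P t) + 1 / 2 * krm * (pdx u 0 t) ^ 2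
      + 1 / 2 * krp * (pdx u ℓ t) ^ 2 + lam * (L t + (1 / 2 * N t + 1 / 2 * kam * (pdx u 0 t) ^ 2
      + 1 / 2 * kap * (pdx u ℓ t) ^ 2)) := by
    funext t
    simp only [hV, hE, hJ]
  have weak : ∀ t ∈ Ioo 0 T, ∀ v v' v'' : ℝ → ℝ, (∀ x, HasDerivAt v (v' x) x) →
      (∀ x, HasDerivAt v' (v'' x) x) → Continuous v'' → v 0 = 0 → v ℓ = 0 →
      (∫ x in (0:ℝ)..ℓ, m x * (v x * pdt (pdt u) x t)) + (∫ x in (0:ℝ)..ℓ, μ x * (v x * pdt u x t))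
        + (∫ x in (0:ℝ)..ℓ, r x * (pdx (pdx u) x t * v'' x))
        + (krm * pdx u 0 t + kam * pdt (pdx u) 0 t) * v' 0
        + (krp * pdx u ℓ t + kap * pdt (pdx u) ℓ t) * v' ℓ = 0 := by
    intro t ht v v' v'' hv hv' cv hv0 hvℓ
    have cv0 : Continuous v := continuous_iff_continuousAt.2 fun x => (hv x).continuousAt
    have hqx := contDiff_pdx hq
    have hparts := integral_deriv_deriv_mul (fun x => hasDerivAt_pdx hq x t)
      (fun x => hasDerivAt_pdx hqx x t) (continuous_slice (contDiff_pdx hqx) t) hv hv' cv hv0 hvℓ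
    have hsum : (∫ x in (0:ℝ)..ℓ, m x * (v x * pdt (pdt u) x t))
        + (∫ x in (0:ℝ)..ℓ, μ x * (v x * pdt u x t))
        + (∫ x in (0:ℝ)..ℓ, pdx (pdx (fun y s => r y * pdx (pdx u) y s)) x t * v x) = 0 := by
      have i1 := int hmc (cv0.fun_mul (continuous_slice hutt t))
      have i2 := int hμc (cv0.fun_mul (continuous_slice hut t))
      rw [← intervalIntegral.integral_add i1 i2, ← intervalIntegral.integral_add (i1.add i2)
        (((continuous_slice (contDiff_pdx hqx) t).fun_mul cv0).intervalIntegrable _ _)]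
      rw [intervalIntegral.integral_congr_Ioo_of_le (g := fun _ => (0 : ℝ)) hℓ.le fun x hx => by
        linear_combination v x * hpde x hx t ht, intervalIntegral.integral_zero]
    simp only [mul_assoc (r _)] at hparts
    have b0 := hbm0 t (Ioo_subset_Icc_self ht)
    have bℓ := hbmℓ t (Ioo_subset_Icc_self ht)
    linear_combination hsum - hparts + v' 0 * b0 - v' ℓ * bℓ
  have two : ∀ w g : ℝ → ℝ,
      (∫ x in (0:ℝ)..ℓ, w x * (2 * g x)) = 2 * ∫ x in (0:ℝ)..ℓ, w x * g x := fun w g => by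
    simp only [mul_left_comm (w _), intervalIntegral.integral_const_mul]
  have hβ₁pos : 0 < 1 + β₁ * lam := by
    have hβ : 0 ≤ β₁ - β₀ := by rw [hβ₁']; positivity
    have : 0 < β₁ := by linarith
    positivity
  have hβ₀lam : 0 < 1 - β₀ * lam := by
    have h := (lt_div_iff₀ hβ₀pos).1 (hlam₂.trans_le (min_le_left _ _))
    linarith
  have hlamγ : 2 * lam ≤ γ := by
    have h := (lt_div_iff₀ (by positivity)).1 (hlam₂.trans_le (min_le_right _ _))
    have hm : m₀ ≤ m₁ := (hmb 0 ⟨le_rfl, hℓ.le⟩).1.trans (hmb 0 ⟨le_rfl, hℓ.le⟩).2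
    refine le_of_mul_le_mul_right ?_ hm₁
    linarith [mul_le_mul_of_nonneg_left hm hγ.le]
  have hdV' := fun t => (hdV t).congr_of_eventuallyEq (Filter.EventuallyEq.of_eq hVeq)
  have hdecay : ∀ t ∈ Ioo 0 T, deriv V t ≤ -(2 * lam) * E t := by
    intro t ht
    have zero_deriv : ∀ y, (∀ s ∈ Icc 0 T, u y s = 0) → pdt u y t = 0 := fun y hy => by
      have h : (fun s => u y s) =ᶠ[nhds t] fun _ => 0 := by
        filter_upwards [Ioo_mem_nhds ht.1 ht.2] with s hs using hy s (Ioo_subset_Icc_self hs)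
      exact h.deriv_eq.trans (deriv_const t 0)
    have hcomm := pdt_pdx_comm hu
    have hcomm2 : pdt (pdx (pdx u)) = pdx (pdx (pdt u)) := by rw [pdt_pdx_comm hux, hcomm]
    have htest_u := weak t ht _ _ _ (fun x => hasDerivAt_pdx hu x t)
      (fun x => hasDerivAt_pdx hux x t) (continuous_slice huxx t)
      (hbu0 t (Ioo_subset_Icc_self ht)) (hbuℓ t (Ioo_subset_Icc_self ht))
    have htest_ut := weak t ht _ _ _ (fun x => hasDerivAt_pdx hut x t)
      (fun x => hasDerivAt_pdx hutx x t) (continuous_slice (contDiff_pdx hutx) t)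
      (zero_deriv 0 hbu0) (zero_deriv ℓ hbuℓ)
    have hdamp : (∫ x in (0:ℝ)..ℓ, μ x * (pdt u x t * pdt u x t)) = γ * K t := by
      rw [hK, ← intervalIntegral.integral_const_mul]
      exact intervalIntegral.integral_congr_Ioo_of_le hℓ.le fun x hx => by
        simp only [hμm x (Ioo_subset_Icc_self hx)]
        ring
    have hPt : (∫ x in (0:ℝ)..ℓ, r x * (pdx (pdx u) x t * pdx (pdx u) x t)) = P t := by
      simp only [hP, sq]
    have hLt : (∫ x in (0:ℝ)..ℓ, m x * (pdt u x t * pdt u x t + u x t * pdt (pdt u) x t))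
        = K t + ∫ x in (0:ℝ)..ℓ, m x * (u x t * pdt (pdt u) x t) := by
      simp only [hK, sq, mul_add]
      exact intervalIntegral.integral_add
        (int hmc ((continuous_slice hut t).fun_mul (continuous_slice hut t)))
        (int hmc ((continuous_slice hu t).fun_mul (continuous_slice hutt t)))
    rw [hPt] at htest_u
    rw [hdamp] at htest_ut
    rw [(hdV' t).deriv, two m, two r, two μ, hLt, hE t, hcomm2]
    rw [hcomm] at htest_u htest_ut ⊢
    have h1 := mul_le_mul_of_nonneg_right hlamγ (hK0 t)
    have h2 : 0 ≤ kam * pdx (pdt u) 0 t ^ 2 := by positivity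
    have h3 : 0 ≤ kap * pdx (pdt u) ℓ t ^ 2 := by positivity
    linear_combination htest_ut + lam * htest_u + h1 + h2 + h3
  intro t ht
  have hV_exp := le_exp_mul_of_deriv_le (σ := σ)
    (fun s => (hdV' s).differentiableAt.hasDerivAt) (fun s hs => by
      refine (hdecay s hs).trans ?_
      have h := mul_le_mul_of_nonneg_left (hV_upper s (Ioo_subset_Icc_self hs))
        (div_nonneg (by positivity : 0 ≤ 2 * lam) hβ₁pos.le)
      rw [← mul_assoc, div_mul_cancel₀ _ hβ₁pos.ne', ← hσ] at h
      linarith) ht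
  have h0 := mul_le_mul_of_nonneg_left (hV_upper 0 ⟨le_rfl, hT.le⟩) (Real.exp_pos (-σ * t)).le
  rw [hM, div_mul_eq_mul_div, div_mul_eq_mul_div, le_div_iff₀ hβ₀lam]
  linarith [hV_lower t ht]
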